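/- arXiv:1504.04256 — 3 statements merged into one kernel-verified Lean document; each statement's English description precedes it below -/
import Mathlib

section
/- Let x ∈ 𝒫 satisfy x₁+⋯+xₙ = 1/2 and let α = t·x for some t > 0. Then the mixed Hessian matrix [∂²W/∂xᵢ∂αⱼ(α,x)]_{1 ≤ i,j ≤ n} is degenerate, i.e. its determinant is zero. -/
/-- The kinetic term `W(α,x)` of the canonical metric on `ℂℙⁿ`, as a function on the
open standard simplex: `W(α,x) = (1/2)(Σᵢ αᵢ²/xᵢ + (Σᵢ αᵢ)²/(1 − Σᵢ xᵢ))`. -/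
noncomputable def Wcp (n : ℕ) (α x : Fin n → ℝ) : ℝ :=
  (1 / 2) * ((∑ i, (α i) ^ 2 / x i) + (∑ i, α i) ^ 2 / (1 - ∑ i, x i))

/-- The interior of the moment polytope of `ℂℙⁿ`: the open standard simplex. -/
def Pcp (n : ℕ) : Set (Fin n → ℝ) := {x | (∀ i, 0 < x i) ∧ ∑ i, x i < 1}

/-- The mixed Hessian matrix `[∂²W/∂xᵢ∂αⱼ(α,x)]` of `Wcp`. -/
noncomputable def Hcp (n : ℕ) (α x : Fin n → ℝ) : Matrix (Fin n) (Fin n) ℝ :=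
  Matrix.of fun i j =>
    fderiv ℝ (fun x' => fderiv ℝ (fun a => Wcp n a x') α (Pi.single j 1)) x (Pi.single i 1)

/-- The `αⱼ`-derivative of `Wcp`. -/
theorem fderiv_Wcp_single (n : ℕ) (α y : Fin n → ℝ) (j : Fin n) :
    fderiv ℝ (fun a => Wcp n a y) α (Pi.single j 1) =
      α j * (y j)⁻¹ + (∑ i, α i) * (1 - ∑ i, y i)⁻¹ := by
  have hcoord (i : Fin n) : HasFDerivAt (fun a : Fin n → ℝ => a i)
      (ContinuousLinearMap.proj (R := ℝ) (φ := fun _ : Fin n => ℝ) i) α := hasFDerivAt_apply i α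
  have h := (((HasFDerivAt.fun_sum (u := Finset.univ) fun i _ =>
    ((hcoord i).pow 2).mul_const (y i)⁻¹).add
    (((HasFDerivAt.fun_sum (u := Finset.univ) fun i _ => hcoord i).pow 2).mul_const
      (1 - ∑ i, y i)⁻¹)).const_mul (1 / 2 : ℝ))
  have hW : HasFDerivAt (fun a => Wcp n a y) _ α := h
  rw [hW.fderiv]
  simp [Pi.single_apply]
  ring

/-- The entries of the mixed Hessian of `Wcp`. -/
theorem Hcp_apply {n : ℕ} (α : Fin n → ℝ) {x : Fin n → ℝ} (hx : x ∈ Pcp n) (i j : Fin n) :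
    Hcp n α x i j =
      (if j = i then -(α j / x j ^ 2) else 0) + (∑ k, α k) / (1 - ∑ k, x k) ^ 2 := by
  have hcoord (k : Fin n) : HasFDerivAt (fun a : Fin n → ℝ => a k)
      (ContinuousLinearMap.proj (R := ℝ) (φ := fun _ : Fin n => ℝ) k) x := hasFDerivAt_apply k x
  have hs : 1 - ∑ k, x k ≠ 0 := (sub_pos.2 hx.2).ne'
  have h := (((hasDerivAt_inv (hx.1 j).ne').comp_hasFDerivAt x (hcoord j)).const_mul (α j)).add
    (((hasDerivAt_inv hs).comp_hasFDerivAt x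
      ((HasFDerivAt.fun_sum (u := Finset.univ) fun k _ => hcoord k).const_sub 1)).const_mul
        (∑ k, α k))
  have hf : HasFDerivAt
      (fun y : Fin n → ℝ => α j * (y j)⁻¹ + (∑ k, α k) * (1 - ∑ k, y k)⁻¹) _ x := h
  simp only [Hcp, Matrix.of_apply, fderiv_Wcp_single]
  rw [hf.fderiv]
  simp [Pi.single_apply, div_eq_mul_inv]
  split_ifs <;> simp

/-- On the hyperplane `Σ xᵢ = 1/2`, for `α = t·x` with `t > 0`, the mixed Hessian
`[∂²W/∂xᵢ∂αⱼ(α,x)]` of the `ℂℙⁿ` kinetic term is degenerate. -/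
theorem stmt_10 {n : ℕ} (hn : 0 < n) (x : Fin n → ℝ) (hx : x ∈ Pcp n)
    (hsum : ∑ i, x i = 1 / 2) (t : ℝ) (ht : 0 < t) :
    (Hcp n (t • x) x).det = 0 := by
  refine Matrix.exists_mulVec_eq_zero_iff.1 ⟨x, fun h => ?_, ?_⟩
  · exact (hx.1 ⟨0, hn⟩).ne' (congrFun h ⟨0, hn⟩)
  · ext i
    have hi : x i ≠ 0 := (hx.1 i).ne'
    simp only [Matrix.mulVec, dotProduct, Hcp_apply _ hx, Pi.smul_apply, smul_eq_mul,
      ← Finset.mul_sum, hsum, add_mul, Finset.sum_add_distrib, ite_mul, zero_mul,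
      Finset.sum_ite_eq', Finset.mem_univ, if_true, Pi.zero_apply]
    field_simp
    ring
end

section
/- For every fixed x ∈ ℛ, the map α ↦ (∂W/∂x₁(α,x), ∂W/∂x₂(α,x)) is injective on the open quadrant {(α₁,α₂) : α₁ > 0, α₂ > 0}, and hence is a diffeomorphism of this quadrant onto an open subset of ℝ². -/
/-- The kinetic term of the canonical metric on the Hirzebruch surface `ℋₙ`:
`W(α,x) = (1/2)[α₁²/x₁ + α₂²/x₂ + α₂²/(1−x₂) + (α₁+nα₂)²/(n+1−x₁−nx₂)]`. -/
noncomputable def Wh (n : ℕ) (a1 a2 x1 x2 : ℝ) : ℝ :=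
  (1 / 2) * (a1 ^ 2 / x1 + a2 ^ 2 / x2 + a2 ^ 2 / (1 - x2)
    + (a1 + n * a2) ^ 2 / (n + 1 - x1 - n * x2))

/-- The interior of the moment polytope of the Hirzebruch surface `ℋₙ`. -/
def Ph (n : ℕ) : Set (ℝ × ℝ) :=
  {x | 0 < x.1 ∧ 0 < x.2 ∧ x.2 < 1 ∧ 0 < n + 1 - x.1 - n * x.2}

/-- The auxiliary quantity `x₂* = √n · x₂(1−x₂)/√(1−2x₂)`. -/
noncomputable def x2star (n : ℕ) (x2 : ℝ) : ℝ :=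
  Real.sqrt n * (x2 * (1 - x2)) / Real.sqrt (1 - 2 * x2)

/-- The subregion `ℛ = {x ∈ 𝒫 : 0 < x₂ < 1/2, x₁ + n x₂* > n+1−x₁−n x₂}`. -/
def Rh (n : ℕ) : Set (ℝ × ℝ) :=
  {x ∈ Ph n | x.2 < 1 / 2 ∧ (n : ℝ) + 1 - x.1 - n * x.2 < x.1 + n * x2star n x.2}

/-- The quadratic map `(a, b) ↦ (k²(a+nb)² − p²a², n(k²(a+nb)² − r²b²)) / 2`. -/
noncomputable def gradQuad (n k p r : ℝ) (a : ℝ × ℝ) : ℝ × ℝ :=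
  ((k ^ 2 * (a.1 + n * a.2) ^ 2 - p ^ 2 * a.1 ^ 2) / 2,
    n * (k ^ 2 * (a.1 + n * a.2) ^ 2 - r ^ 2 * a.2 ^ 2) / 2)

/-- The derivative of `gradQuad n k p r` at `a`. -/
noncomputable def gradQuadDeriv (n k p r : ℝ) (a : ℝ × ℝ) : ℝ × ℝ →L[ℝ] ℝ × ℝ :=
  ((k ^ 2 * (a.1 + n * a.2)) •
      (ContinuousLinearMap.fst ℝ ℝ ℝ + n • ContinuousLinearMap.snd ℝ ℝ ℝ)
    - (p ^ 2 * a.1) • ContinuousLinearMap.fst ℝ ℝ ℝ).prod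
  (n • ((k ^ 2 * (a.1 + n * a.2)) •
      (ContinuousLinearMap.fst ℝ ℝ ℝ + n • ContinuousLinearMap.snd ℝ ℝ ℝ)
    - (r ^ 2 * a.2) • ContinuousLinearMap.snd ℝ ℝ ℝ))

theorem gradQuadDeriv_apply (n k p r : ℝ) (a v : ℝ × ℝ) :
    gradQuadDeriv n k p r a v =
      (k ^ 2 * (a.1 + n * a.2) * (v.1 + n * v.2) - p ^ 2 * a.1 * v.1,
        n * (k ^ 2 * (a.1 + n * a.2) * (v.1 + n * v.2) - r ^ 2 * a.2 * v.2)) := by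
  simp [gradQuadDeriv, mul_add]

theorem hasStrictFDerivAt_gradQuad (n k p r : ℝ) (a : ℝ × ℝ) :
    HasStrictFDerivAt (gradQuad n k p r) (gradQuadDeriv n k p r a) a := by
  have h1 : HasStrictFDerivAt (fun a : ℝ × ℝ => a.1) (ContinuousLinearMap.fst ℝ ℝ ℝ) a :=
    hasStrictFDerivAt_fst
  have h2 : HasStrictFDerivAt (fun a : ℝ × ℝ => a.2) (ContinuousLinearMap.snd ℝ ℝ ℝ) a :=
    hasStrictFDerivAt_snd
  have hs := ((h1.add (h2.const_mul n)).pow 2).const_mul (k ^ 2)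
  have hf := (hs.sub ((h1.pow 2).const_mul (p ^ 2))).mul_const (2⁻¹ : ℝ)
  have hg := ((hs.sub ((h2.pow 2).const_mul (r ^ 2))).const_mul n).mul_const (2⁻¹ : ℝ)
  refine (hf.prodMk hg).congr_fderiv ?_
  refine ContinuousLinearMap.ext fun v => ?_
  rw [gradQuadDeriv_apply]
  ext <;> simp <;> ring

theorem gradQuad_sub (n k p r : ℝ) (a b : ℝ × ℝ) :
    gradQuad n k p r a - gradQuad n k p r b =
      (1 / 2 : ℝ) • gradQuadDeriv n k p r (a + b) (a - b) := by
  rw [gradQuadDeriv_apply]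
  ext <;> simp [gradQuad] <;> ring

theorem gradQuadDeriv_injective {n k p r : ℝ} (hn : 0 < n) (hp : 0 < p)
    (hr : 0 < r) (h : p * r < k * (r + n * p)) {a : ℝ × ℝ} (ha1 : 0 < a.1) (ha2 : 0 < a.2) :
    Function.Injective (gradQuadDeriv n k p r a) := by
  rw [injective_iff_map_eq_zero]
  intro v hv
  rw [gradQuadDeriv_apply, Prod.mk_eq_zero, mul_eq_zero] at hv
  obtain ⟨h1, h2⟩ := hv
  replace h2 := h2.resolve_left hn.ne'
  obtain ⟨a, b⟩ := a
  obtain ⟨v, w⟩ := v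
  simp only at ha1 ha2 h1 h2 ⊢
  have hab := mul_pos ha1 ha2
  have hsq : (p * r) ^ 2 < (k * (r + n * p)) ^ 2 := by gcongr
  have hdet : 0 < k ^ 2 * (a + n * b) * (r ^ 2 * b + n * p ^ 2 * a) - p ^ 2 * r ^ 2 * (a * b) := by
    have e : k ^ 2 * (a + n * b) * (r ^ 2 * b + n * p ^ 2 * a) - p ^ 2 * r ^ 2 * (a * b) =
        ((k * (r + n * p)) ^ 2 - (p * r) ^ 2) * (a * b) + n * (k * (p * a - r * b)) ^ 2 := by ring
    rw [e]
    have := mul_pos (sub_pos.2 hsq) hab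
    positivity
  have hv : v = 0 := by
    refine (mul_eq_zero.1 ?_).resolve_left hdet.ne'
    linear_combination (r ^ 2 * b - n * k ^ 2 * (a + n * b)) * h1
      + n * k ^ 2 * (a + n * b) * h2
  have hw : w = 0 := by
    refine (mul_eq_zero.1 ?_).resolve_left hdet.ne'
    linear_combination k ^ 2 * (a + n * b) * h1 + (p ^ 2 * a - k ^ 2 * (a + n * b)) * h2
  rw [hv, hw, Prod.mk_zero_zero]

theorem gradQuad_injOn {n k p r : ℝ} (hn : 0 < n) (hp : 0 < p)
    (hr : 0 < r) (h : p * r < k * (r + n * p)) :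
    Set.InjOn (gradQuad n k p r) {a : ℝ × ℝ | 0 < a.1 ∧ 0 < a.2} := by
  intro a ha b hb hab
  have h0 := gradQuad_sub n k p r a b
  rw [hab, sub_self, eq_comm, smul_eq_zero] at h0
  refine sub_eq_zero.1 (gradQuadDeriv_injective hn hp hr h (a := a + b)
    (add_pos ha.1 hb.1) (add_pos ha.2 hb.2) ?_)
  rw [map_zero]
  exact h0.resolve_left (by norm_num)

theorem isOpen_gradQuad_image {n k p r : ℝ} (hn : 0 < n) (hp : 0 < p)
    (hr : 0 < r) (h : p * r < k * (r + n * p)) :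
    IsOpen (gradQuad n k p r '' {a : ℝ × ℝ | 0 < a.1 ∧ 0 < a.2}) := by
  rw [isOpen_iff_mem_nhds]
  rintro _ ⟨a, ha, rfl⟩
  have hsurj : (gradQuadDeriv n k p r a).range = ⊤ :=
    LinearMap.range_eq_top.2 (LinearMap.injective_iff_surjective.1
      (gradQuadDeriv_injective hn hp hr h ha.1 ha.2))
  rw [← (hasStrictFDerivAt_gradQuad n k p r a).map_nhds_eq_of_surj hsurj]
  refine Filter.image_mem_map (IsOpen.mem_nhds ?_ ha)
  exact (isOpen_lt continuous_const continuous_fst).inter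
    (isOpen_lt continuous_const continuous_snd)

theorem deriv_Wh_fst {n : ℕ} {x : ℝ × ℝ} (hx : x ∈ Ph n) (a1 a2 : ℝ) :
    deriv (fun t => Wh n a1 a2 t x.2) x.1 =
      ((n + 1 - x.1 - n * x.2)⁻¹ ^ 2 * (a1 + n * a2) ^ 2 - x.1⁻¹ ^ 2 * a1 ^ 2) / 2 := by
  obtain ⟨hu, -, -, hd⟩ := hx
  have h1 := (hasDerivAt_const x.1 (a1 ^ 2)).div (hasDerivAt_id x.1) hu.ne'
  have h2 := (hasDerivAt_const x.1 ((a1 + n * a2) ^ 2)).div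
    (((hasDerivAt_id x.1).const_sub ((n : ℝ) + 1)).sub_const (n * x.2)) hd.ne'
  have h := (((h1.add_const (a2 ^ 2 / x.2)).add_const (a2 ^ 2 / (1 - x.2))).add h2).const_mul
    (1 / 2 : ℝ)
  refine (HasDerivAt.deriv (h : HasDerivAt (fun t => Wh n a1 a2 t x.2) _ x.1)).trans ?_
  simp only [id]
  have := hu.ne'
  have := hd.ne'
  field_simp
  ring

theorem deriv_Wh_snd {n : ℕ} {x : ℝ × ℝ} (hx : x ∈ Ph n) (a1 a2 : ℝ) :
    deriv (fun t => Wh n a1 a2 x.1 t) x.2 =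
      (n * ((n + 1 - x.1 - n * x.2)⁻¹ ^ 2 * (a1 + n * a2) ^ 2)
        - (1 - 2 * x.2) / (x.2 * (1 - x.2)) ^ 2 * a2 ^ 2) / 2 := by
  obtain ⟨-, hy, hy1, hd⟩ := hx
  have hy' : 1 - x.2 ≠ 0 := (sub_pos.2 hy1).ne'
  have h1 := (hasDerivAt_const x.2 (a2 ^ 2)).div (hasDerivAt_id x.2) hy.ne'
  have h2 := (hasDerivAt_const x.2 (a2 ^ 2)).div ((hasDerivAt_id x.2).const_sub 1) hy'
  have h3 := (hasDerivAt_const x.2 ((a1 + n * a2) ^ 2)).div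
    (((hasDerivAt_id x.2).const_mul (n : ℝ)).const_sub ((n : ℝ) + 1 - x.1)) hd.ne'
  have h := (((h1.const_add (a1 ^ 2 / x.1)).add h2).add h3).const_mul (1 / 2 : ℝ)
  refine (HasDerivAt.deriv (h : HasDerivAt (fun t => Wh n a1 a2 x.1 t) _ x.2)).trans ?_
  simp only [id]
  have := hy.ne'
  have := hd.ne'
  field_simp
  ring

theorem inv_x2star_sq {n : ℕ} {x2 : ℝ} (hn : n ≠ 0) (h : x2 < 1 / 2) :
    n * (x2star n x2)⁻¹ ^ 2 = (1 - 2 * x2) / (x2 * (1 - x2)) ^ 2 := by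
  have hn' : (n : ℝ) ≠ 0 := Nat.cast_ne_zero.2 hn
  rw [x2star, inv_div, div_pow, mul_pow, Real.sq_sqrt (by linarith), Real.sq_sqrt n.cast_nonneg,
    mul_div_assoc', mul_div_mul_left _ _ hn']

/-- For every fixed `x ∈ ℛ`, the map `α ↦ (∂W/∂x₁(α,x), ∂W/∂x₂(α,x))` is injective
on the open quadrant `{α₁ > 0, α₂ > 0}`, and hence a diffeomorphism of this
quadrant onto an open subset of `ℝ²`. -/
theorem stmt_17 (n : ℕ) (hn : 1 ≤ n) (x : ℝ × ℝ) (hx : x ∈ Rh n) :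
    Set.InjOn
        (fun a : ℝ × ℝ =>
          (deriv (fun t => Wh n a.1 a.2 t x.2) x.1,
            deriv (fun t => Wh n a.1 a.2 x.1 t) x.2))
        {a : ℝ × ℝ | 0 < a.1 ∧ 0 < a.2} ∧
      IsOpen ((fun a : ℝ × ℝ =>
          (deriv (fun t => Wh n a.1 a.2 t x.2) x.1,
            deriv (fun t => Wh n a.1 a.2 x.1 t) x.2)) ''
        {a : ℝ × ℝ | 0 < a.1 ∧ 0 < a.2}) := by
  obtain ⟨hP, hhalf, hR⟩ := hx
  obtain ⟨hu, hy, hy1, hd⟩ := id hP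
  have hn' : (0 : ℝ) < n := Nat.cast_pos.2 hn
  have hq : 0 < x2star n x.2 :=
    div_pos (mul_pos (Real.sqrt_pos.2 hn') (mul_pos hy (by linarith)))
      (Real.sqrt_pos.2 (by linarith))
  have hf : (fun a : ℝ × ℝ =>
      (deriv (fun t => Wh n a.1 a.2 t x.2) x.1, deriv (fun t => Wh n a.1 a.2 x.1 t) x.2)) =
      gradQuad n (n + 1 - x.1 - n * x.2)⁻¹ x.1⁻¹ (x2star n x.2)⁻¹ := by
    funext a
    rw [deriv_Wh_fst hP, deriv_Wh_snd hP, gradQuad, ← inv_x2star_sq (n := n) (by omega) hhalf]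
    ring_nf
  have h : x.1⁻¹ * (x2star n x.2)⁻¹ <
      (n + 1 - x.1 - n * x.2)⁻¹ * ((x2star n x.2)⁻¹ + n * x.1⁻¹) := by
    have e : (x2star n x.2)⁻¹ + n * x.1⁻¹ =
        (x.1 + n * x2star n x.2) * (x.1⁻¹ * (x2star n x.2)⁻¹) := by
      field_simp
    rw [e, ← mul_assoc]
    refine lt_mul_of_one_lt_left (by positivity) ?_
    rwa [inv_mul_eq_div, one_lt_div hd]
  rw [hf]
  exact ⟨gradQuad_injOn hn' (inv_pos.2 hu) (inv_pos.2 hq) h,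
    isOpen_gradQuad_image hn' (inv_pos.2 hu) (inv_pos.2 hq) h⟩
end

section
/- Let V be a real-valued function that is C¹ on an open neighborhood of the closure of 𝒫, strictly convex on 𝒫, and which satisfies: ∂V/∂x₂(x) > 0 at every x ∈ 𝒫 with x₂ = 1/2, and ∂V/∂x₁(x) < 0 and ∂V/∂x₂(x) < 0 at every x ∈ 𝒫 with 0 < x₂ < 1/2 and x₁ = (n+1)/2 − (n/2)(x₂ + x₂*). Then for every α = (α₁,α₂) with α₁,α₂ > 0, the function x ↦ V(x) + W(α,x) attains a unique global minimum on 𝒫, and the minimizer lies in ℛ. -/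
open Set

lemma isOpen_Ph (n : ℕ) : IsOpen (Ph n) := by
  refine IsOpen.and (isOpen_lt (by fun_prop) (by fun_prop)) (IsOpen.and
    (isOpen_lt (by fun_prop) (by fun_prop)) (IsOpen.and
    (isOpen_lt (by fun_prop) (by fun_prop)) (isOpen_lt (by fun_prop) (by fun_prop))))

lemma isCompact_closure_Ph (n : ℕ) : IsCompact (closure (Ph n)) := by
  refine Bornology.IsBounded.isCompact_closure
    ((Metric.isBounded_Icc ((0 : ℝ), (0 : ℝ)) ((n : ℝ) + 1, 1)).subset ?_)
  rintro ⟨x, y⟩ ⟨h1, h2, h3, h4⟩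
  simp only at h1 h2 h3 h4
  have : 0 ≤ (n : ℝ) * y := by positivity
  exact ⟨⟨h1.le, h2.le⟩, ⟨by simp only; linarith, h3.le⟩⟩

lemma div_convex_combination_le {a b c u v : ℝ} (ha : 0 ≤ a) (hb : 0 ≤ b) (hab : a + b = 1)
    (hc : 0 ≤ c) (hu : 0 < u) (hv : 0 < v) :
    c / (a * u + b * v) ≤ a * (c / u) + b * (c / v) := by
  have h := (convexOn_zpow (𝕜 := ℝ) (-1)).2 (mem_Ioi.2 hu) (mem_Ioi.2 hv) ha hb hab
  simp only [smul_eq_mul, zpow_neg_one] at h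
  calc c / (a * u + b * v) = c * (a * u + b * v)⁻¹ := div_eq_mul_inv _ _
    _ ≤ c * (a * u⁻¹ + b * v⁻¹) := mul_le_mul_of_nonneg_left h hc
    _ = _ := by ring

lemma convexOn_Wh (n : ℕ) (a1 a2 : ℝ) (hP : Convex ℝ (Ph n)) :
    ConvexOn ℝ (Ph n) fun x => Wh n a1 a2 x.1 x.2 := by
  refine ⟨hP, ?_⟩
  rintro ⟨x1, x2⟩ ⟨hx1, hx2, hx3, hx4⟩ ⟨y1, y2⟩ ⟨hy1, hy2, hy3, hy4⟩ a b ha hb hab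
  simp only at hx1 hx2 hx3 hx4 hy1 hy2 hy3 hy4
  simp only [Wh, Prod.smul_mk, Prod.mk_add_mk, smul_eq_mul]
  have h1 := div_convex_combination_le ha hb hab (sq_nonneg a1) hx1 hy1
  have h2 := div_convex_combination_le ha hb hab (sq_nonneg a2) hx2 hy2
  have h3 := div_convex_combination_le ha hb hab (sq_nonneg a2) (sub_pos.2 hx3) (sub_pos.2 hy3)
  have h4 := div_convex_combination_le ha hb hab (sq_nonneg (a1 + n * a2)) hx4 hy4
  rw [show a * (1 - x2) + b * (1 - y2) = 1 - (a * x2 + b * y2) by linear_combination hab] at h3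
  rw [show a * (n + 1 - x1 - n * x2) + b * (n + 1 - y1 - n * y2)
    = n + 1 - (a * x1 + b * y1) - n * (a * x2 + b * y2) by
      linear_combination ((n : ℝ) + 1) * hab] at h4
  linarith

lemma HasFDerivAt.const_div_real {E : Type*} [NormedAddCommGroup E] [NormedSpace ℝ E]
    {l : E → ℝ} {l' : E →L[ℝ] ℝ} {x : E} (c : ℝ) (h : HasFDerivAt l l' x) (hx : l x ≠ 0) :
    HasFDerivAt (fun y => c / l y) ((-c / l x ^ 2) • l') x := by
  have h1 : HasDerivAt (fun t : ℝ => c / t) (-c / l x ^ 2) (l x) := by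
    simpa [div_eq_mul_inv] using (hasDerivAt_inv hx).const_mul c
  exact h1.comp_hasFDerivAt x h

/-- The partial derivative of `Wh` in the first variable. -/
noncomputable def WhFst (n : ℕ) (a1 a2 x1 x2 : ℝ) : ℝ :=
  (1 / 2) * ((a1 + n * a2) ^ 2 / (n + 1 - x1 - n * x2) ^ 2 - a1 ^ 2 / x1 ^ 2)

/-- The partial derivative of `Wh` in the second variable. -/
noncomputable def WhSnd (n : ℕ) (a1 a2 x1 x2 : ℝ) : ℝ :=
  (1 / 2) * (n * ((a1 + n * a2) ^ 2 / (n + 1 - x1 - n * x2) ^ 2)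
    - a2 ^ 2 / x2 ^ 2 + a2 ^ 2 / (1 - x2) ^ 2)

lemma exists_hasFDerivAt_Wh (n : ℕ) (a1 a2 : ℝ) {x : ℝ × ℝ} (hx : x ∈ Ph n) :
    ∃ W' : ℝ × ℝ →L[ℝ] ℝ, HasFDerivAt (fun y : ℝ × ℝ => Wh n a1 a2 y.1 y.2) W' x ∧
      W' (1, 0) = WhFst n a1 a2 x.1 x.2 ∧ W' (0, 1) = WhSnd n a1 a2 x.1 x.2 := by
  obtain ⟨h1, h2, h3, h4⟩ := hx
  have d1 : HasFDerivAt (fun y : ℝ × ℝ => y.1) (ContinuousLinearMap.fst ℝ ℝ ℝ) x := hasFDerivAt_fst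
  have d2 : HasFDerivAt (fun y : ℝ × ℝ => y.2) (ContinuousLinearMap.snd ℝ ℝ ℝ) x := hasFDerivAt_snd
  have d3 := d2.const_sub 1
  have d4 := (d1.const_sub ((n : ℝ) + 1)).sub (d2.const_mul (n : ℝ))
  have D := ((((d1.const_div_real (a1 ^ 2) h1.ne').add (d2.const_div_real (a2 ^ 2) h2.ne')).add
    (d3.const_div_real (a2 ^ 2) (sub_pos.2 h3).ne')).add
    (d4.const_div_real ((a1 + n * a2) ^ 2) h4.ne')).const_mul (1 / 2 : ℝ)
  refine ⟨_, D, ?_, ?_⟩ <;> simp [WhFst, WhSnd] <;> ring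

lemma ConvexOn.hasFDerivAt_sub_le {E : Type*} [NormedAddCommGroup E] [NormedSpace ℝ E]
    {S : Set E} {f : E → ℝ} {f' : E →L[ℝ] ℝ} {p x : E} (hf : ConvexOn ℝ S f)
    (h : HasFDerivAt f f' p) (hp : p ∈ S) (hx : x ∈ S) : f' (x - p) ≤ f x - f p := by
  have hg := hf.comp_affineMap (AffineMap.lineMap p x : ℝ →ᵃ[ℝ] E)
  have hd : HasDerivAt (f ∘ (AffineMap.lineMap p x : ℝ →ᵃ[ℝ] E)) (f' (x - p)) 0 := by
    refine HasFDerivAt.comp_hasDerivAt 0 ?_ AffineMap.hasDerivAt_lineMap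
    simpa using h
  have := hg.le_slope_of_hasDerivAt (x := 0) (y := 1) (by simpa using hp) (by simpa using hx)
    one_pos hd
  simpa [slope_def_field] using this

lemma exists_forall_le_add_Wh (n : ℕ) {V : ℝ × ℝ → ℝ} (hV : ContinuousOn V (closure (Ph n)))
    {a1 a2 : ℝ} (ha1 : 0 < a1) (ha2 : 0 < a2) :
    ∃ x₀ ∈ Ph n, ∀ x ∈ Ph n, V x₀ + Wh n a1 a2 x₀.1 x₀.2 ≤ V x + Wh n a1 a2 x.1 x.2 := by
  obtain ⟨m, hm⟩ := (isCompact_closure_Ph n).bddBelow_image hV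
  have hm' : ∀ x ∈ Ph n, m ≤ V x := fun x hx => hm ⟨x, subset_closure hx, rfl⟩
  have hq : ((1 / 4 : ℝ), (1 / 4 : ℝ)) ∈ Ph n := by
    have : (0 : ℝ) ≤ n := n.cast_nonneg
    refine ⟨by norm_num, by norm_num, by norm_num, ?_⟩
    simp only
    linarith
  set q : ℝ × ℝ := ((1 / 4 : ℝ), (1 / 4 : ℝ))
  set M := V q + Wh n a1 a2 q.1 q.2 with hM
  set B := |M - m| + 1
  have hB : 0 < B := by positivity
  set c := min (a1 ^ 2) (a2 ^ 2)
  have hc : 0 < c := by positivity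
  have hc1 : c ≤ a1 ^ 2 := min_le_left _ _
  have hc2 : c ≤ a2 ^ 2 := min_le_right _ _
  have hc3 : c ≤ (a1 + n * a2) ^ 2 := hc1.trans (by gcongr; nlinarith [n.cast_nonneg (α := ℝ)])
  set ε := c / (2 * B)
  have hε : 0 < ε := by positivity
  have key : ∀ x ∈ Ph n, V x + Wh n a1 a2 x.1 x.2 ≤ M →
      ε ≤ x.1 ∧ ε ≤ x.2 ∧ ε ≤ 1 - x.2 ∧ ε ≤ n + 1 - x.1 - n * x.2 := by
    intro x hx hxM
    have h0 := hm' x hx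
    obtain ⟨h1, h2, h3, h4⟩ := hx
    have h3' := sub_pos.2 h3
    have hW : Wh n a1 a2 x.1 x.2 < B := by
      have := le_abs_self (M - m)
      simp only [B]; linarith
    have aux : ∀ {d l : ℝ}, c ≤ d → 0 < l → d / l < 2 * B → ε ≤ l := by
      intro d l hd hl h
      rw [div_lt_iff₀ hl] at h
      rw [div_le_iff₀ (by positivity)]
      linarith
    have t1 : 0 ≤ a1 ^ 2 / x.1 := by positivity
    have t2 : 0 ≤ a2 ^ 2 / x.2 := by positivity
    have t3 : 0 ≤ a2 ^ 2 / (1 - x.2) := by positivity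
    have t4 : 0 ≤ (a1 + n * a2) ^ 2 / (n + 1 - x.1 - n * x.2) := by positivity
    unfold Wh at hW
    exact ⟨aux hc1 h1 (by linarith), aux hc2 h2 (by linarith), aux hc2 h3' (by linarith),
      aux hc3 h4 (by linarith)⟩
  set K : Set (ℝ × ℝ) := {x | ε ≤ x.1 ∧ ε ≤ x.2 ∧ ε ≤ 1 - x.2 ∧ ε ≤ n + 1 - x.1 - n * x.2}
  have hKP : K ⊆ Ph n := fun x ⟨h1, h2, h3, h4⟩ =>
    ⟨by linarith, by linarith, by linarith, by linarith⟩
  have hKc : IsClosed K := by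
    refine IsClosed.and (isClosed_le (by fun_prop) (by fun_prop)) (IsClosed.and
      (isClosed_le (by fun_prop) (by fun_prop)) (IsClosed.and
      (isClosed_le (by fun_prop) (by fun_prop)) (isClosed_le (by fun_prop) (by fun_prop))))
  have hK : IsCompact K :=
    (isCompact_closure_Ph n).of_isClosed_subset hKc (hKP.trans subset_closure)
  have hqK : q ∈ K := key q hq le_rfl
  have hcont : ContinuousOn (fun x => V x + Wh n a1 a2 x.1 x.2) K := by
    refine (hV.mono (hKP.trans subset_closure)).add fun x hx => ?_
    obtain ⟨W', hW', -⟩ := exists_hasFDerivAt_Wh n a1 a2 (hKP hx)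
    exact hW'.continuousAt.continuousWithinAt
  obtain ⟨x₀, hx₀, hmin⟩ := hK.exists_isMinOn ⟨q, hqK⟩ hcont
  refine ⟨x₀, hKP hx₀, fun x hx => ?_⟩
  rcases le_total (V x + Wh n a1 a2 x.1 x.2) M with h | h
  · exact hmin (key x hx h)
  · exact le_trans (hmin hqK) h

lemma monotoneOn_x2star (n : ℕ) : MonotoneOn (x2star n) (Ioo 0 (1 / 2)) := by
  rintro s ⟨hs0, hs⟩ t ⟨ht0, ht⟩ hst
  unfold x2star
  have h1 : 0 < Real.sqrt (1 - 2 * t) := Real.sqrt_pos.2 (by linarith)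
  have h2 : s * (1 - s) ≤ t * (1 - t) := by nlinarith
  have h3 : 0 ≤ t * (1 - t) := by nlinarith
  gcongr

lemma x2star_pos {n : ℕ} (hn : 1 ≤ n) {t : ℝ} (h0 : 0 < t) (ht : t < 1 / 2) : 0 < x2star n t := by
  have h1 : 0 < Real.sqrt (1 - 2 * t) := Real.sqrt_pos.2 (by linarith)
  have h2 : 0 < Real.sqrt n := Real.sqrt_pos.2 (by exact_mod_cast hn)
  have h3 : 0 < 1 - t := by linarith
  unfold x2star
  positivity

lemma continuousOn_x2star (n : ℕ) : ContinuousOn (x2star n) (Ioo 0 (1 / 2)) := by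
  unfold x2star
  refine ContinuousOn.div (by fun_prop) (by fun_prop) fun t ht => ?_
  exact (Real.sqrt_pos.2 (by linarith [ht.2])).ne'

lemma two_le_x2star {n : ℕ} (hn : 1 ≤ n) : 2 ≤ x2star n (255 / 512) := by
  have h1 : Real.sqrt (1 - 2 * (255 / 512)) = 1 / 16 := by
    rw [Real.sqrt_eq_iff_mul_self_eq (by norm_num) (by norm_num)]; norm_num
  have h2 : 1 ≤ Real.sqrt n := Real.one_le_sqrt.2 (by exact_mod_cast hn)
  rw [x2star, h1, le_div_iff₀ (by norm_num)]
  linarith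

/-- The first coordinate of the left boundary curve of `Rh n` at height `t`. -/
noncomputable def curveFst (n : ℕ) (t : ℝ) : ℝ :=
  ((n : ℝ) + 1) / 2 - ((n : ℝ) / 2) * (t + x2star n t)

lemma antitoneOn_curveFst (n : ℕ) : AntitoneOn (curveFst n) (Ioo 0 (1 / 2)) := by
  intro s hs t ht hst
  have := monotoneOn_x2star n hs ht hst
  unfold curveFst
  gcongr

lemma continuousOn_curveFst (n : ℕ) : ContinuousOn (curveFst n) (Ioo 0 (1 / 2)) := by
  have := continuousOn_x2star n
  unfold curveFst
  fun_prop

lemma curveFst_nonpos {n : ℕ} (hn : 1 ≤ n) : curveFst n (255 / 512) ≤ 0 := by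
  have h1 := two_le_x2star hn
  have h2 : (1 : ℝ) ≤ n := by exact_mod_cast hn
  unfold curveFst
  nlinarith

lemma curve_compl_eq (n : ℕ) (t : ℝ) :
    (n : ℝ) + 1 - curveFst n t - n * t = curveFst n t + n * x2star n t := by
  unfold curveFst; ring

lemma curve_mem_Ph {n : ℕ} (hn : 1 ≤ n) {t : ℝ} (h0 : 0 < t) (ht : t < 1 / 2)
    (hc : 0 < curveFst n t) : (curveFst n t, t) ∈ Ph n := by
  have := x2star_pos hn h0 ht
  refine ⟨hc, h0, by simp only; linarith, ?_⟩
  simp only [curve_compl_eq]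
  positivity

lemma WhSnd_half_pos {n : ℕ} (hn : 1 ≤ n) {a1 a2 x1 : ℝ} (ha1 : 0 < a1) (ha2 : 0 < a2)
    (hx : (x1, (1 / 2 : ℝ)) ∈ Ph n) : 0 < WhSnd n a1 a2 x1 (1 / 2) := by
  have h4 := hx.2.2.2
  simp only at h4
  have h2 : (0 : ℝ) < n := by exact_mod_cast hn
  have : 0 < (n : ℝ) * ((a1 + n * a2) ^ 2 / (n + 1 - x1 - n * (1 / 2)) ^ 2) := by positivity
  unfold WhSnd
  norm_num at this ⊢
  linarith

lemma WhFst_or_WhSnd_nonpos {n : ℕ} (hn : 1 ≤ n) {a1 a2 t : ℝ} (ha1 : 0 < a1) (ha2 : 0 < a2)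
    (h0 : 0 < t) (ht : t < 1 / 2) (hc : 0 < curveFst n t) :
    WhFst n a1 a2 (curveFst n t) t ≤ 0 ∨ WhSnd n a1 a2 (curveFst n t) t ≤ 0 := by
  have hs := x2star_pos hn h0 ht
  have hn0 : (0 : ℝ) < n := by exact_mod_cast hn
  have hs2 : x2star n t ^ 2 = n * (t * (1 - t)) ^ 2 / (1 - 2 * t) := by
    rw [x2star, div_pow, mul_pow, Real.sq_sqrt hn0.le, Real.sq_sqrt (by linarith)]
  have h1t : 0 < 1 - t := by linarith
  have h2t : 0 < 1 - 2 * t := by linarith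
  have hdiff : a2 ^ 2 / t ^ 2 - a2 ^ 2 / (1 - t) ^ 2 = n * (a2 ^ 2 / x2star n t ^ 2) := by
    rw [hs2]; field_simp; ring
  unfold WhFst WhSnd
  rw [curve_compl_eq]
  generalize x2star n t = s at *
  generalize curveFst n t = u at *
  simp only [← div_pow] at hdiff ⊢
  have hm : 0 < (a1 + n * a2) / (u + n * s) := by positivity
  rcases le_total (a1 * s) (a2 * u) with h | h
  · right
    have : (a1 + n * a2) / (u + n * s) ≤ a2 / s := by
      rw [div_le_div_iff₀ (by positivity) hs]; nlinarith
    have := pow_le_pow_left₀ hm.le this 2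
    nlinarith
  · left
    have : (a1 + n * a2) / (u + n * s) ≤ a1 / u := by
      rw [div_le_div_iff₀ (by positivity) hc]; nlinarith
    have := pow_le_pow_left₀ hm.le this 2
    linarith

lemma exists_curveFst_eq {n : ℕ} (hn : 1 ≤ n) {x s : ℝ} (hx : 0 < x) (h0 : 0 < s) (hs : s < 1 / 2)
    (hxs : x ≤ curveFst n s) : ∃ t, s ≤ t ∧ t < 1 / 2 ∧ curveFst n t = x := by
  have h255 := curveFst_nonpos hn
  have hle : s ≤ 255 / 512 := by
    by_contra! h
    have := antitoneOn_curveFst n (by norm_num) ⟨h0, hs⟩ h.le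
    linarith
  have hsub : Icc s (255 / 512) ⊆ Ioo 0 (1 / 2) :=
    fun t ht => ⟨by linarith [ht.1], by norm_num at ht ⊢; linarith [ht.2]⟩
  obtain ⟨t, ht, hxt⟩ := intermediate_value_Icc' hle ((continuousOn_curveFst n).mono hsub)
    ⟨by linarith, hxs⟩
  exact ⟨t, ht.1, (hsub ht).2, hxt⟩

/-- Let `V` be `C¹` on an open neighborhood of the closure of `𝒫`, strictly convex
on `𝒫`, with `∂V/∂x₂ > 0` on the line `x₂ = 1/2` and `∂V/∂x₁ < 0`, `∂V/∂x₂ < 0` on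
the curve `x₁ = (n+1)/2 − (n/2)(x₂ + x₂*)`, `0 < x₂ < 1/2`.  Then for every
`α₁, α₂ > 0` the function `x ↦ V(x) + W(α,x)` attains a unique global minimum on
`𝒫`, and the minimizer lies in `ℛ`. -/
theorem stmt_18 (n : ℕ) (hn : 1 ≤ n) (V : ℝ × ℝ → ℝ)
    (hV : ∃ O : Set (ℝ × ℝ), IsOpen O ∧ closure (Ph n) ⊆ O ∧ ContDiffOn ℝ 1 V O)
    (hVconv : StrictConvexOn ℝ (Ph n) V)
    (hVline : ∀ x ∈ Ph n, x.2 = 1 / 2 → 0 < fderiv ℝ V x (0, 1))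
    (hVcurve : ∀ x ∈ Ph n, 0 < x.2 → x.2 < 1 / 2 →
      x.1 = ((n : ℝ) + 1) / 2 - ((n : ℝ) / 2) * (x.2 + x2star n x.2) →
      fderiv ℝ V x (1, 0) < 0 ∧ fderiv ℝ V x (0, 1) < 0)
    (a1 a2 : ℝ) (ha1 : 0 < a1) (ha2 : 0 < a2) :
    ∃ x₀ ∈ Rh n,
      (∀ x ∈ Ph n, V x₀ + Wh n a1 a2 x₀.1 x₀.2 ≤ V x + Wh n a1 a2 x.1 x.2) ∧
      ∀ x ∈ Ph n,
        (∀ y ∈ Ph n, V x + Wh n a1 a2 x.1 x.2 ≤ V y + Wh n a1 a2 y.1 y.2) → x = x₀ := by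
  obtain ⟨O, hO, hPO, hVO⟩ := hV
  have hPO' : Ph n ⊆ O := subset_closure.trans hPO
  have hVd : ∀ p ∈ Ph n, HasFDerivAt V (fderiv ℝ V p) p := fun p hp =>
    ((hVO.differentiableOn one_ne_zero).differentiableAt
      (hO.mem_nhds (hPO' hp))).hasFDerivAt
  have hVc : ContinuousOn (fderiv ℝ V) (Ph n) :=
    (hVO.continuousOn_fderiv_of_isOpen hO le_rfl).mono hPO'
  obtain ⟨x₀, hx₀, hmin⟩ := exists_forall_le_add_Wh n (hVO.continuousOn.mono hPO) ha1 ha2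
  have hconv : StrictConvexOn ℝ (Ph n) fun x => V x + Wh n a1 a2 x.1 x.2 :=
    hVconv.add_convexOn (convexOn_Wh n a1 a2 hVconv.1)
  have hcrit : ∀ p ∈ Ph n,
      (fderiv ℝ V p (1, 0) + WhFst n a1 a2 p.1 p.2) * (x₀.1 - p.1)
        + (fderiv ℝ V p (0, 1) + WhSnd n a1 a2 p.1 p.2) * (x₀.2 - p.2) ≤ 0 ∧
      (p = x₀ → fderiv ℝ V p (1, 0) + WhFst n a1 a2 p.1 p.2 = 0 ∧
        fderiv ℝ V p (0, 1) + WhSnd n a1 a2 p.1 p.2 = 0) := by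
    intro p hp
    obtain ⟨W', hW', e1, e2⟩ := exists_hasFDerivAt_Wh n a1 a2 hp
    have hd := (hVd p hp).add hW'
    rw [← e1, ← e2, ← add_apply, ← add_apply]
    refine ⟨?_, ?_⟩
    · have h := hconv.convexOn.hasFDerivAt_sub_le hd hp hx₀
      have hsplit : x₀ - p = (x₀.1 - p.1) • ((1 : ℝ), (0 : ℝ))
          + (x₀.2 - p.2) • ((0 : ℝ), (1 : ℝ)) := by
        ext <;> simp
      rw [hsplit, map_add, map_smul, map_smul, smul_eq_mul, smul_eq_mul] at h
      have := hmin p hp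
      linarith
    · rintro rfl
      have hloc : IsLocalMin (fun x => V x + Wh n a1 a2 x.1 x.2) p :=
        Filter.mem_of_superset ((isOpen_Ph n).mem_nhds hp) hmin
      rw [hloc.hasFDerivAt_eq_zero hd]
      simp
  have hhalf : x₀.2 < 1 / 2 := by
    by_contra! hge
    have hp : (x₀.1, (1 / 2 : ℝ)) ∈ Ph n := by
      refine ⟨hx₀.1, by norm_num, by norm_num, ?_⟩
      have h4 := hx₀.2.2.2
      simp only
      nlinarith [mul_le_mul_of_nonneg_left hge (n.cast_nonneg (α := ℝ))]
    have hpos := add_pos (hVline _ hp rfl) (WhSnd_half_pos hn ha1 ha2 hp)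
    obtain ⟨h1, h2⟩ := hcrit _ hp
    rcases hge.eq_or_lt with h | h
    · exact hpos.ne' (h2 (Prod.ext rfl h)).2
    · simp only [sub_self, mul_zero, zero_add] at h1
      nlinarith [mul_pos hpos (sub_pos.2 h)]
  have hright : curveFst n x₀.2 < x₀.1 := by
    by_contra! hle
    have hx1 := hx₀.1
    have hx2 := hx₀.2.1
    obtain ⟨t, hst, ht, hxt⟩ := exists_curveFst_eq hn hx1 hx2 hhalf hle
    have hsub : Icc x₀.2 t ⊆ Ioo 0 (1 / 2) :=
      fun r hr => ⟨hx2.trans_le hr.1, hr.2.trans_lt ht⟩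
    have hge : ∀ r ∈ Icc x₀.2 t, x₀.1 ≤ curveFst n r := fun r hr =>
      hxt ▸ antitoneOn_curveFst n (hsub hr) ⟨hx2.trans_le hst, ht⟩ hr.2
    have hmem : ∀ r ∈ Icc x₀.2 t, (curveFst n r, r) ∈ Ph n := fun r hr =>
      curve_mem_Ph hn (hsub hr).1 (hsub hr).2 (hx1.trans_le (hge r hr))
    set D1 : ℝ → ℝ := fun r =>
      fderiv ℝ V (curveFst n r, r) (1, 0) + WhFst n a1 a2 (curveFst n r) r with hD1
    set D2 : ℝ → ℝ := fun r =>
      fderiv ℝ V (curveFst n r, r) (0, 1) + WhSnd n a1 a2 (curveFst n r) r with hD2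
    have hneg : ∀ r ∈ Icc x₀.2 t, D1 r < 0 ∨ D2 r < 0 := by
      intro r hr
      obtain ⟨v1, v2⟩ := hVcurve _ (hmem r hr) (hsub hr).1 (hsub hr).2 rfl
      exact (WhFst_or_WhSnd_nonpos hn ha1 ha2 (hsub hr).1 (hsub hr).2 (hmem r hr).1).imp
        (add_neg_of_neg_of_nonpos v1) (add_neg_of_neg_of_nonpos v2)
    have hineq : ∀ r ∈ Icc x₀.2 t,
        D1 r * (x₀.1 - curveFst n r) + D2 r * (x₀.2 - r) ≤ 0 ∧
          ((curveFst n r, r) = x₀ → D1 r = 0 ∧ D2 r = 0) := fun r hr => hcrit _ (hmem r hr)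
    have hnot : ∀ r ∈ Icc x₀.2 t, ¬ (D1 r < 0 ∧ D2 r < 0) := by
      rintro r hr ⟨d1, d2⟩
      obtain ⟨h1, h2⟩ := hineq r hr
      have m1 := mul_nonneg_of_nonpos_of_nonpos d1.le (sub_nonpos.2 (hge r hr))
      have m2 := mul_nonneg_of_nonpos_of_nonpos d2.le (sub_nonpos.2 hr.1)
      have z1 : D1 r * (x₀.1 - curveFst n r) = 0 := by linarith
      have z2 : D2 r * (x₀.2 - r) = 0 := by linarith
      have w1 := (mul_eq_zero.1 z1).resolve_left d1.ne
      have w2 := (mul_eq_zero.1 z2).resolve_left d2.ne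
      exact d1.ne (h2 (Prod.ext (by simp only; linarith) (by simp only; linarith))).1
    have hcont : ContinuousOn (fun r => D1 r - D2 r) (Icc x₀.2 t) := by
      have c0 := (continuousOn_curveFst n).mono hsub
      have c1 : ContinuousOn (fun r => (curveFst n r, r)) (Icc x₀.2 t) := c0.prodMk continuousOn_id
      have c2 := hVc.comp c1 hmem
      have n1 : ∀ r ∈ Icc x₀.2 t, curveFst n r ^ 2 ≠ 0 := fun r hr =>
        pow_ne_zero _ (hmem r hr).1.ne'
      have n2 : ∀ r ∈ Icc x₀.2 t, r ^ 2 ≠ 0 := fun r hr => pow_ne_zero _ (hmem r hr).2.1.ne'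
      have n3 : ∀ r ∈ Icc x₀.2 t, (1 - r) ^ 2 ≠ 0 := fun r hr =>
        pow_ne_zero _ (sub_pos.2 (hmem r hr).2.2.1).ne'
      have n4 : ∀ r ∈ Icc x₀.2 t, ((n : ℝ) + 1 - curveFst n r - n * r) ^ 2 ≠ 0 := fun r hr =>
        pow_ne_zero _ (hmem r hr).2.2.2.ne'
      have cv : ∀ v : ℝ × ℝ, ContinuousOn (fun r => fderiv ℝ V (curveFst n r, r) v)
          (Icc x₀.2 t) := fun v => c2.clm_apply continuousOn_const
      refine ((cv _).add ?_).sub ((cv _).add ?_)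
      · unfold WhFst
        fun_prop (disch := assumption)
      · unfold WhSnd
        fun_prop (disch := assumption)
    have hs : x₀.2 ∈ Icc x₀.2 t := ⟨le_rfl, hst⟩
    have ht' : t ∈ Icc x₀.2 t := ⟨hst, le_rfl⟩
    have hDs : 0 ≤ D1 x₀.2 := by
      by_contra! h
      obtain ⟨h1, h2⟩ := hineq _ hs
      rw [sub_self, mul_zero, add_zero] at h1
      rcases hle.eq_or_lt with e | e
      · exact h.ne (h2 (Prod.ext e.symm rfl)).1
      · nlinarith
    have hDt : 0 ≤ D2 t := by
      by_contra! h
      obtain ⟨h1, h2⟩ := hineq _ ht'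
      rw [hxt, sub_self, mul_zero, zero_add] at h1
      rcases hst.eq_or_lt with e | e
      · exact h.ne (h2 (Prod.ext hxt e.symm)).2
      · nlinarith
    have hDs' := (hneg _ hs).resolve_left hDs.not_gt
    have hDt' := (hneg _ ht').resolve_right hDt.not_gt
    obtain ⟨r, hr, hr0⟩ := intermediate_value_Icc' hst hcont
      (show (0 : ℝ) ∈ Icc _ _ from ⟨by linarith, by linarith⟩)
    have heq : D1 r = D2 r := sub_eq_zero.1 hr0
    refine hnot r hr ?_
    rcases hneg r hr with h | h
    · exact ⟨h, heq ▸ h⟩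
    · exact ⟨heq ▸ h, h⟩
  refine ⟨x₀, ⟨hx₀, hhalf, ?_⟩, hmin, fun x hx hxmin => ?_⟩
  · unfold curveFst at hright
    linarith
  · exact hconv.eq_of_isMinOn hxmin hmin hx hx₀
end
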